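/- arXiv:2510.13012 — 3 statements merged into one kernel-verified Lean document; each statement's English description precedes it below -/
import Mathlib

section
/- Let n > 1 be a real number and set m = 1 - 1/n, so 0 < m < 1. Then ∫₀^1 (1 - s^(1/m))^(-m) ds = m·Γ(m)·Γ(1 - m) = m·π / sin(π·m). In particular the auxiliary variable u of the van Genuchten model is bounded on [0,1] by m·π / sin(π·m). -/
theorem integral_rpow_mul_one_sub_rpow {m : ℝ} (h0 : 0 < m) (h1 : m < 1) :
    (∫ t in (0:ℝ)..1, t ^ (m - 1) * (1 - t) ^ (-m)) = Real.Gamma m * Real.Gamma (1 - m) := by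
  have hsum : m + (1 - m) = 1 := by ring
  have h := ProbabilityTheory.beta_eq_betaIntegralReal m (1 - m) h0 (by linarith)
  rw [ProbabilityTheory.beta, hsum, Real.Gamma_one, div_one] at h
  rw [h, Complex.betaIntegral, ← Complex.ofReal_re (∫ t in (0:ℝ)..1, _),
    ← intervalIntegral.integral_ofReal]
  congr 1
  refine intervalIntegral.integral_congr fun t ht => ?_
  rw [Set.uIcc_of_le zero_le_one] at ht
  have ht1 : 0 ≤ 1 - t := by linarith [ht.2]
  simp only [Complex.ofReal_mul, Complex.ofReal_cpow ht.1, Complex.ofReal_cpow ht1]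
  push_cast
  ring_nf

theorem integral_one_sub_rpow_inv_rpow_neg {m : ℝ} (h0 : 0 < m) (h1 : m < 1) :
    (∫ s in (0:ℝ)..1, (1 - s ^ (1 / m)) ^ (-m)) = m * Real.Gamma m * Real.Gamma (1 - m) := by
  have hc := intervalIntegral.integral_comp_mul_deriv_of_deriv_nonneg (a := 0) (b := 1)
    (f := fun t : ℝ => t ^ m) (f' := fun t : ℝ => m * t ^ (m - 1))
    (g := fun s : ℝ => (1 - s ^ (1 / m)) ^ (-m))
    (Real.continuous_rpow_const h0.le).continuousOn
    (fun t ht => by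
      rw [min_eq_left zero_le_one, max_eq_right zero_le_one] at ht
      exact (Real.hasDerivAt_rpow_const (Or.inl ht.1.ne')))
    (fun t ht => by
      rw [min_eq_left zero_le_one, max_eq_right zero_le_one] at ht
      exact mul_nonneg h0.le (Real.rpow_nonneg ht.1.le _))
  simp only [Real.zero_rpow h0.ne', Real.one_rpow] at hc
  rw [← hc, mul_assoc, ← integral_rpow_mul_one_sub_rpow h0 h1,
    ← intervalIntegral.integral_const_mul]
  refine intervalIntegral.integral_congr fun t ht => ?_
  rw [Set.uIcc_of_le zero_le_one] at ht
  simp only [Function.comp, one_div, Real.rpow_rpow_inv ht.1 h0.ne']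
  ring

/-- For the van Genuchten model with `n > 1` and `m = 1 - 1/n` (so `0 < m < 1`),
`∫₀^1 (1 - s^(1/m))^(-m) ds = m·Γ(m)·Γ(1-m) = m·π / sin(π·m)`; in particular the auxiliary
variable `u(S) = ∫₀^S (1 - s^(1/m))^(-m) ds` is bounded on `[0,1]` by `m·π / sin(π·m)`. -/
theorem stmt_7 (n : ℝ) (hn : 1 < n) (m : ℝ) (hm : m = 1 - 1 / n) :
    0 < m ∧ m < 1 ∧
    (∫ s in (0:ℝ)..1, (1 - s ^ (1 / m)) ^ (-m)) = m * Real.Gamma m * Real.Gamma (1 - m) ∧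
    (∫ s in (0:ℝ)..1, (1 - s ^ (1 / m)) ^ (-m)) = m * Real.pi / Real.sin (Real.pi * m) ∧
    ∀ S ∈ Set.Icc (0 : ℝ) 1,
      (∫ s in (0:ℝ)..S, (1 - s ^ (1 / m)) ^ (-m)) ≤ m * Real.pi / Real.sin (Real.pi * m) := by
  have hn0 : 0 < 1 / n := by positivity
  have hn1 : 1 / n < 1 := (div_lt_one (by linarith)).2 hn
  have h0 : 0 < m := by linarith
  have h1 : m < 1 := by linarith
  have hI := integral_one_sub_rpow_inv_rpow_neg h0 h1
  have hpi : (∫ s in (0:ℝ)..1, (1 - s ^ (1 / m)) ^ (-m)) =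
      m * Real.pi / Real.sin (Real.pi * m) := by
    rw [hI, mul_assoc, Real.Gamma_mul_Gamma_one_sub, mul_div_assoc]
  refine ⟨h0, h1, hI, hpi, fun S hS => ?_⟩
  have hpos : 0 < m * Real.Gamma m * Real.Gamma (1 - m) :=
    mul_pos (mul_pos h0 (Real.Gamma_pos_of_pos h0)) (Real.Gamma_pos_of_pos (by linarith))
  have hfi : IntervalIntegrable (fun s : ℝ => (1 - s ^ (1 / m)) ^ (-m))
      MeasureTheory.volume 0 1 := by
    by_contra hni
    exact hpos.ne' (hI.symm.trans (intervalIntegral.integral_undef hni))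
  rw [← hpi]
  refine intervalIntegral.integral_mono_interval le_rfl hS.1 hS.2 ?_ hfi
  filter_upwards [MeasureTheory.ae_restrict_mem measurableSet_Ioc] with s hs
  exact Real.rpow_nonneg
    (sub_nonneg.2 (Real.rpow_le_one hs.1.le hs.2 (one_div_pos.2 h0).le)) _
end

section
/- Let n > 1 be a real number and set m = 1 - 1/n. Let K_r(S) = S^(1/2)·(1 - (1 - S^(1/m))^m)² for S ∈ (0,1]. Then the limit of K_r(S)·S^(-1/m) as S → 0⁺ exists, is finite, and equals 0. -/
/-- For `x ∈ [0, 1]` and `m ≤ 1`, the increment `1 - (1 - x) ^ m` is at most `x`. -/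
lemma one_sub_one_sub_rpow_le {x m : ℝ} (hx0 : 0 ≤ x) (hx1 : x ≤ 1)
    (hm1 : m ≤ 1) : 1 - (1 - x) ^ m ≤ x := by
  have h := Real.self_le_rpow_of_le_one (sub_nonneg.2 hx1) (sub_le_self 1 hx0) hm1
  linarith

/-- For the van Genuchten–Mualem model with `n > 1` and `m = 1 - 1/n`, with relative
permeability `K_r(S) = S^(1/2)·(1 - (1 - S^(1/m))^m)²`, the limit of `K_r(S)·S^(-1/m)`
as `S → 0⁺` exists, is finite, and equals `0`. -/
theorem stmt_8 (n : ℝ) (hn : 1 < n) (m : ℝ) (hm : m = 1 - 1 / n)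
    (Kr : ℝ → ℝ) (hKr : ∀ S : ℝ, Kr S = S ^ ((1:ℝ)/2) * (1 - (1 - S ^ (1 / m)) ^ m) ^ 2) :
    Filter.Tendsto (fun S : ℝ => Kr S * S ^ (-(1 / m)))
      (nhdsWithin 0 (Set.Ioi 0)) (nhds 0) := by
  have hn0 : 0 < n := by linarith
  have hm0 : 0 < m := by
    rw [hm, sub_pos, div_lt_one hn0]
    exact hn
  have hm1 : m ≤ 1 := by
    rw [hm]
    exact sub_le_self 1 (by positivity)
  have hlim : Filter.Tendsto (fun S : ℝ => S ^ ((1 : ℝ) / 2))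
      (nhdsWithin 0 (Set.Ioi 0)) (nhds 0) := by
    have h := (Real.continuousAt_rpow_const 0 ((1 : ℝ) / 2) (Or.inr (by norm_num))).tendsto
    rw [Real.zero_rpow (by norm_num)] at h
    exact h.mono_left nhdsWithin_le_nhds
  refine squeeze_zero' ?_ ?_ hlim
  · filter_upwards [self_mem_nhdsWithin] with S hS
    have hS0 : 0 < S := hS
    rw [hKr]
    positivity
  · filter_upwards [Ioo_mem_nhdsGT (zero_lt_one' ℝ)] with S hS
    obtain ⟨hS0, hS1⟩ := hS
    rw [hKr, Real.rpow_neg hS0.le, mul_assoc]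
    refine mul_le_of_le_one_right (by positivity) ?_
    have hx0 : 0 < S ^ (1 / m) := by positivity
    have hx1 : S ^ (1 / m) ≤ 1 := Real.rpow_le_one hS0.le hS1.le (by positivity)
    generalize S ^ (1 / m) = x at hx0 hx1 ⊢
    have hle := one_sub_one_sub_rpow_le hx0.le hx1 hm1
    have hge : 0 ≤ 1 - (1 - x) ^ m :=
      sub_nonneg.2 (Real.rpow_le_one (by linarith) (by linarith) hm0.le)
    rw [← div_eq_mul_inv, div_le_one hx0]
    nlinarith
end

section
/- Let n > 1 be a real number and set m = 1 - 1/n. Let K_r(S) = S^(1/2)·(1 - (1 - S^(1/m))^m)² for S ∈ (0,1]. Then the function S ↦ K_r(S)·S^(-1/m) is bounded on the interval (0,1]. -/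
/-- For the van Genuchten–Mualem model with `n > 1` and `m = 1 - 1/n`, with relative
permeability `K_r(S) = S^(1/2)·(1 - (1 - S^(1/m))^m)²`, the function
`S ↦ K_r(S)·S^(-1/m)` is bounded on `(0,1]`. -/
theorem stmt_9 (n : ℝ) (hn : 1 < n) (m : ℝ) (hm : m = 1 - 1 / n)
    (Kr : ℝ → ℝ) (hKr : ∀ S : ℝ, Kr S = S ^ ((1:ℝ)/2) * (1 - (1 - S ^ (1 / m)) ^ m) ^ 2) :
    ∃ M : ℝ, ∀ S ∈ Set.Ioc (0 : ℝ) 1, |Kr S * S ^ (-(1 / m))| ≤ M := by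
  have hn0 : 0 < n := by linarith
  have hm0 : 0 < m := by
    rw [hm, sub_pos, div_lt_one hn0]
    exact hn
  have hm1 : m ≤ 1 := by
    rw [hm]
    exact sub_le_self _ (by positivity)
  refine ⟨1, fun S hS => ?_⟩
  obtain ⟨hS0, hS1⟩ := hS
  rw [hKr, Real.rpow_neg hS0.le]
  have hx0 : 0 < S ^ (1 / m) := Real.rpow_pos_of_pos hS0 _
  have hx1 : S ^ (1 / m) ≤ 1 := Real.rpow_le_one hS0.le hS1 (by positivity)
  have hr0 : 0 ≤ S ^ ((1:ℝ)/2) := Real.rpow_nonneg hS0.le _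
  have hr1 : S ^ ((1:ℝ)/2) ≤ 1 := Real.rpow_le_one hS0.le hS1 (by norm_num)
  generalize S ^ (1 / m) = x at *
  generalize S ^ ((1:ℝ)/2) = r at *
  have hle : (1 - x) ^ m ≤ 1 := Real.rpow_le_one (by linarith) (by linarith) hm0.le
  have hge : 1 - x ≤ (1 - x) ^ m :=
    Real.self_le_rpow_of_le_one (by linarith) (by linarith) hm1
  have hsq : (1 - (1 - x) ^ m) ^ 2 ≤ x ^ 2 :=
    pow_le_pow_left₀ (by linarith) (by linarith) 2
  rw [abs_of_nonneg (by positivity), ← div_eq_mul_inv, div_le_one hx0]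
  calc r * (1 - (1 - x) ^ m) ^ 2 ≤ 1 * x ^ 2 := by gcongr
    _ ≤ x := by nlinarith
end
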